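/- Let μ > 0 be real. Suppose for each ν > 0, λ(ν) > 0 satisfies the mean constraint Σ_{y=0}^∞ (y − μ) λ(ν)^y/(y!)^ν = 0. Then λ(ν)/μ^ν → ∞ and λ(ν)/(μ+1)^ν → 0 as ν → ∞. -/

import Mathlib

open Filter Real Topology

/-- Normalizing function of the Conway–Maxwell–Poisson distribution:
`Z(λ, ν) = ∑_{y=0}^∞ λ^y / (y!)^ν`. -/
noncomputable def cmpZ (l ν : ℝ) : ℝ := ∑' y : ℕ, l ^ y / (y.factorial : ℝ) ^ ν

/-- pmf of the CMP distribution: `P(Y = y) = λ^y / ((y!)^ν Z(λ, ν))`. -/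
noncomputable def cmpPmf (l ν : ℝ) (y : ℕ) : ℝ :=
  l ^ y / (y.factorial : ℝ) ^ ν / cmpZ l ν

/-- The mean constraint `∑_{y=0}^∞ (y − μ) λ^y / (y!)^ν = 0`. -/
def meanConstraint (μ l ν : ℝ) : Prop :=
  ∑' y : ℕ, ((y : ℝ) - μ) * l ^ y / (y.factorial : ℝ) ^ ν = 0

theorem summable_add_mul_pow_div_factorial (μ D : ℝ) (hμ : 0 ≤ μ) (hD : 0 ≤ D) :
    Summable fun y : ℕ => ((y : ℝ) + μ) * D ^ y / (y.factorial : ℝ) := by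
  refine Summable.of_nonneg_of_le (fun y => by positivity) (fun y => ?_)
    ((Real.summable_pow_div_factorial (2 * D)).mul_left (1 + μ))
  rw [← mul_div_assoc, mul_pow, ← mul_assoc]
  have h1 : (y : ℝ) ≤ 2 ^ y := by exact_mod_cast Nat.lt_two_pow_self.le
  have h2 : (1 : ℝ) ≤ 2 ^ y := one_le_pow₀ (by norm_num)
  gcongr
  nlinarith

/-- The series in the mean constraint converges. -/
theorem summable_mean_terms (μ l ν : ℝ) (hμ : 0 ≤ μ) (hl : 0 ≤ l) (hν : 1 ≤ ν) :
    Summable fun y : ℕ => ((y : ℝ) - μ) * l ^ y / (y.factorial : ℝ) ^ ν := by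
  refine Summable.of_norm_bounded (summable_add_mul_pow_div_factorial μ l hμ hl) (fun y => ?_)
  have hy : (1 : ℝ) ≤ y.factorial := by exact_mod_cast y.factorial_pos
  rw [norm_div, norm_mul, Real.norm_of_nonneg (pow_nonneg hl y),
    Real.norm_of_nonneg (by positivity : (0 : ℝ) ≤ (y.factorial : ℝ) ^ ν)]
  have h1 : ‖(y : ℝ) - μ‖ ≤ y + μ := by
    rw [Real.norm_eq_abs, abs_le]
    constructor <;> linarith [(Nat.cast_nonneg y : (0 : ℝ) ≤ y)]
  have h2 : (y.factorial : ℝ) ≤ (y.factorial : ℝ) ^ ν := Real.self_le_rpow_of_one_le hy hν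
  gcongr

theorem pow_mul_factorial_le {μ : ℝ} (hμ : 0 ≤ μ) {m : ℕ} (hm : μ ≤ m + 1) (k : ℕ) :
    μ ^ k * m.factorial ≤ ((m + k).factorial : ℝ) := by
  induction k with
  | zero => simp
  | succ k ih =>
    rw [← add_assoc, Nat.factorial_succ, pow_succ']
    push_cast
    rw [mul_assoc]
    have : μ ≤ (m : ℝ) + k + 1 := by linarith [(Nat.cast_nonneg k : (0 : ℝ) ≤ k)]
    gcongr

theorem pow_mul_factorial_lt {μ : ℝ} (hμ : 0 < μ) {m y : ℕ} (hm : μ ≤ m + 1) (hmy : m < y)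
    (hy : μ < y) : μ ^ (y - m) * m.factorial < (y.factorial : ℝ) := by
  obtain ⟨k, rfl⟩ := Nat.exists_eq_add_of_lt hmy
  rw [show m + k + 1 - m = k + 1 by omega, Nat.factorial_succ, pow_succ', mul_assoc]
  rw [Nat.cast_mul]
  exact mul_lt_mul hy (pow_mul_factorial_le hμ.le hm k) (by positivity) (by positivity)

theorem factorial_le_mul_pow {b : ℝ} (y k : ℕ) (hb : (y + k : ℕ) ≤ b) :
    ((y + k).factorial : ℝ) ≤ y.factorial * b ^ k := by
  induction k with
  | zero => simp
  | succ k ih =>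
    have h := ih (le_trans (by push_cast; linarith) hb)
    have hb0 : 0 ≤ b := (Nat.cast_nonneg _).trans hb
    rw [← add_assoc, Nat.factorial_succ, pow_succ', mul_left_comm, Nat.cast_mul]
    exact mul_le_mul hb h (by positivity) hb0

theorem factorial_lt_mul_pow {b : ℝ} {y n : ℕ} (hyn : y < n) (hn : n ≤ b)
    (hy : (y : ℝ) + 1 < b) : (n.factorial : ℝ) < y.factorial * b ^ (n - y) := by
  obtain ⟨k, rfl⟩ := Nat.exists_eq_add_of_lt hyn
  have hb : 0 < b := lt_trans (by positivity) hy
  have h := factorial_le_mul_pow (b := b) (y + 1) k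
    (by rwa [show y + 1 + k = y + k + 1 by omega])
  rw [show y + k + 1 - y = k + 1 by omega, show y + k + 1 = y + 1 + k by omega]
  refine h.trans_lt ?_
  rw [Nat.factorial_succ, pow_succ', ← mul_assoc, mul_comm (y.factorial : ℝ)]
  push_cast
  gcongr

/-- A family dominating the rescaled terms of the mean constraint when `λ ≤ C μ ^ ν`. -/
noncomputable def upperTerm (μ C : ℝ) (m : ℕ) (ν : ℝ) (y : ℕ) : ℝ :=
  if μ < y then ((y : ℝ) - μ) * C ^ (y - m) * (μ ^ (y - m) * m.factorial / y.factorial) ^ ν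
  else if y = m then (m : ℝ) - μ else 0

theorem norm_upperTerm_le {μ C ν : ℝ} {m : ℕ} (hμ : 0 < μ) (hC : 0 < C) (hm : (m : ℝ) < μ)
    (hm' : μ ≤ m + 1) (hν : 1 ≤ ν) (y : ℕ) :
    ‖upperTerm μ C m ν y‖ ≤
      (m.factorial : ℝ) * (((y : ℝ) + μ) * max 1 (C * μ) ^ y / (y.factorial : ℝ)) := by
  have hD : 1 ≤ max 1 (C * μ) := le_max_left _ _
  set D := max 1 (C * μ) with hDdef
  unfold upperTerm
  split_ifs with h h'
  · have hmy : m < y := by exact_mod_cast hm.trans h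
    have hlt := pow_mul_factorial_lt hμ hm' hmy h
    have hr : (μ ^ (y - m) * m.factorial / y.factorial) ^ ν ≤
        μ ^ (y - m) * m.factorial / y.factorial :=
      Real.rpow_le_self_of_le_one (by positivity) ((div_le_one (by positivity)).2 hlt.le) hν
    have hs : 0 < (y : ℝ) - μ := sub_pos.2 h
    rw [Real.norm_of_nonneg (by positivity)]
    have hp : (C * μ) ^ (y - m) ≤ D ^ y :=
      (pow_le_pow_left₀ (by positivity) (le_max_right _ _) _).trans
        (pow_le_pow_right₀ hD (Nat.sub_le _ _))
    calc _ ≤ ((y : ℝ) - μ) * C ^ (y - m) * (μ ^ (y - m) * m.factorial / y.factorial) := by gcongr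
      _ = (m.factorial : ℝ) * (((y : ℝ) - μ) * (C * μ) ^ (y - m) / (y.factorial : ℝ)) := by
        rw [mul_pow]; ring
      _ ≤ _ := by
        have : (y : ℝ) - μ ≤ y + μ := by linarith
        gcongr
  · subst h'
    have h1 : (1 : ℝ) ≤ D ^ y := one_le_pow₀ hD
    rw [mul_div_cancel₀ _ (by positivity), Real.norm_eq_abs, abs_of_neg (sub_neg.2 hm)]
    nlinarith [(Nat.cast_nonneg y : (0 : ℝ) ≤ y)]
  · rw [norm_zero]; positivity

theorem summable_upperTerm_bound {μ : ℝ} (C : ℝ) (m : ℕ) (hμ : 0 < μ) :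
    Summable fun y : ℕ =>
      (m.factorial : ℝ) * (((y : ℝ) + μ) * max 1 (C * μ) ^ y / (y.factorial : ℝ)) :=
  (summable_add_mul_pow_div_factorial μ _ hμ.le
    (zero_le_one.trans (le_max_left 1 (C * μ)))).mul_left _

theorem tendsto_tsum_upperTerm {μ C : ℝ} {m : ℕ} (hμ : 0 < μ) (hC : 0 < C) (hm : (m : ℝ) < μ)
    (hm' : μ ≤ m + 1) :
    Tendsto (fun ν => ∑' y, upperTerm μ C m ν y) atTop (𝓝 (m - μ)) := by
  have key := tendsto_tsum_of_dominated_convergence (𝓕 := atTop)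
    (f := fun ν y => upperTerm μ C m ν y) (g := fun y => if y = m then (m : ℝ) - μ else 0)
    (summable_upperTerm_bound C m hμ) (fun y => ?_)
    ((eventually_ge_atTop 1).mono fun ν hν y => norm_upperTerm_le hμ hC hm hm' hν y)
  · rwa [tsum_ite_eq] at key
  · unfold upperTerm
    split_ifs with h h'
    · subst h'; exact absurd h hm.not_gt
    · have hmy : m < y := by exact_mod_cast hm.trans h
      have hlt := pow_mul_factorial_lt hμ hm' hmy h
      have h0 : 0 < μ ^ (y - m) * m.factorial / (y.factorial : ℝ) := by positivity
      simpa using (tendsto_rpow_atTop_of_base_lt_one _ (by linarith)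
        ((div_lt_one (by positivity)).2 hlt)).const_mul (((y : ℝ) - μ) * C ^ (y - m))
    · exact tendsto_const_nhds
    · exact tendsto_const_nhds

theorem mean_term_le_upperTerm {μ C l ν : ℝ} {m : ℕ} (hμ : 0 < μ) (hl : 0 < l)
    (hm : (m : ℝ) < μ) (hlC : l ≤ C * μ ^ ν) (y : ℕ) :
    (m.factorial : ℝ) ^ ν / l ^ m * (((y : ℝ) - μ) * l ^ y / (y.factorial : ℝ) ^ ν) ≤
      upperTerm μ C m ν y := by
  unfold upperTerm
  have hf : ∀ k : ℕ, (0 : ℝ) < (k.factorial : ℝ) ^ ν := fun k => by positivity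
  split_ifs with h h'
  · have hmy : m < y := by exact_mod_cast hm.trans h
    have hs : 0 < (y : ℝ) - μ := sub_pos.2 h
    have hp : l ^ (y - m) ≤ (C * μ ^ ν) ^ (y - m) := pow_le_pow_left₀ hl.le hlC _
    rw [Real.div_rpow (by positivity) (by positivity), Real.mul_rpow (by positivity)
      (by positivity), ← Real.rpow_pow_comm hμ.le]
    calc _ = ((y : ℝ) - μ) * l ^ (y - m) * ((m.factorial : ℝ) ^ ν / (y.factorial : ℝ) ^ ν) := by
          rw [pow_sub₀ l hl.ne' hmy.le]; ring
      _ ≤ ((y : ℝ) - μ) * (C * μ ^ ν) ^ (y - m) *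
          ((m.factorial : ℝ) ^ ν / (y.factorial : ℝ) ^ ν) := by gcongr
      _ = _ := by rw [mul_pow]; ring
  · subst h'
    have := (hf y).ne'
    apply le_of_eq
    field_simp
  · have : (y : ℝ) - μ ≤ 0 := by linarith
    refine mul_nonpos_of_nonneg_of_nonpos (by positivity) ?_
    exact div_nonpos_of_nonpos_of_nonneg
      (mul_nonpos_of_nonpos_of_nonneg this (by positivity)) (hf y).le

theorem eventually_lt_of_meanConstraint {μ : ℝ} (hμ : 0 < μ) {C : ℝ} (hC : 0 < C) :
    ∀ᶠ ν in atTop, ∀ l, 0 < l → meanConstraint μ l ν → C * μ ^ ν < l := by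
  obtain ⟨m, hm, hm'⟩ : ∃ m : ℕ, (m : ℝ) < μ ∧ μ ≤ m + 1 := by
    have h0 := Nat.ceil_pos.2 hμ
    refine ⟨⌈μ⌉₊ - 1, Nat.lt_ceil.1 (by omega), ?_⟩
    have := Nat.le_ceil μ
    rwa [← Nat.cast_add_one, Nat.sub_add_cancel h0]
  filter_upwards [eventually_ge_atTop 1,
    (tendsto_tsum_upperTerm hμ hC hm hm').eventually_lt_const (sub_neg.2 hm)]
    with ν hν hneg l hl hmean
  by_contra! hlC
  have hle := ((summable_mean_terms μ l ν hμ.le hl.le hν).mul_left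
    ((m.factorial : ℝ) ^ ν / l ^ m)).tsum_le_tsum
    (mean_term_le_upperTerm hμ hl hm hlC)
    (Summable.of_norm_bounded (summable_upperTerm_bound C m hμ)
      (norm_upperTerm_le hμ hC hm hm' hν))
  rw [tsum_mul_left, hmean, mul_zero] at hle
  linarith

theorem mean_term_ge {μ ε l ν : ℝ} {n y : ℕ} (hμ : 0 < μ) (hε : 0 < ε) (hyn : y < n)
    (hy : (y : ℝ) ≤ μ) (hl : ε * (μ + 1) ^ ν ≤ l) :
    -((μ - y) * ε⁻¹ ^ (n - y) * (n.factorial / (y.factorial * (μ + 1) ^ (n - y))) ^ ν) ≤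
      (n.factorial : ℝ) ^ ν / l ^ n * (((y : ℝ) - μ) * l ^ y / (y.factorial : ℝ) ^ ν) := by
  have hl0 : 0 < l := lt_of_lt_of_le (by positivity) hl
  have hs : 0 ≤ μ - y := sub_nonneg.2 hy
  rw [Real.div_rpow (by positivity) (by positivity), Real.mul_rpow (by positivity)
    (by positivity), ← Real.rpow_pow_comm (by positivity), neg_le]
  calc _ = (μ - y) * (n.factorial : ℝ) ^ ν / (y.factorial : ℝ) ^ ν / l ^ (n - y) := by
        rw [pow_sub₀ l hl0.ne' hyn.le]; field_simp; ring
    _ ≤ (μ - y) * (n.factorial : ℝ) ^ ν / (y.factorial : ℝ) ^ ν /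
        (ε * (μ + 1) ^ ν) ^ (n - y) := by gcongr
    _ = _ := by rw [mul_pow, inv_pow]; field_simp

theorem eventually_gt_of_meanConstraint {μ : ℝ} (hμ : 0 < μ) {ε : ℝ} (hε : 0 < ε) :
    ∀ᶠ ν in atTop, ∀ l, 0 < l → meanConstraint μ l ν → l < ε * (μ + 1) ^ ν := by
  obtain ⟨n, hn, hn'⟩ : ∃ n : ℕ, μ < n ∧ (n : ℝ) ≤ μ + 1 :=
    ⟨⌊μ⌋₊ + 1, by exact_mod_cast Nat.lt_floor_add_one μ, by
      push_cast; linarith [Nat.floor_le hμ.le]⟩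
  have hlow : ∀ y ∈ Finset.range n, (y : ℝ) ≤ μ := fun y hy => by
    have : ((y + 1 : ℕ) : ℝ) ≤ n := by exact_mod_cast Finset.mem_range.1 hy
    push_cast at this
    linarith
  have hlim : Tendsto (fun ν : ℝ => ∑ y ∈ Finset.range n, (μ - y) * ε⁻¹ ^ (n - y) *
      ((n.factorial : ℝ) / (y.factorial * (μ + 1) ^ (n - y))) ^ ν) atTop (𝓝 0) := by
    rw [← Finset.sum_const_zero (s := Finset.range n)]
    refine tendsto_finsetSum _ fun y hy => ?_
    rcases (hlow y hy).eq_or_lt with h | h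
    · simp [h]
    · have hlt := factorial_lt_mul_pow (b := μ + 1) (Finset.mem_range.1 hy) hn' (by linarith)
      have h0 : 0 < (n.factorial : ℝ) / (y.factorial * (μ + 1) ^ (n - y)) := by positivity
      simpa using (tendsto_rpow_atTop_of_base_lt_one _ (by linarith)
        ((div_lt_one (by positivity)).2 hlt)).const_mul ((μ - y) * ε⁻¹ ^ (n - y))
  filter_upwards [eventually_ge_atTop 1, hlim.eventually_lt_const (sub_pos.2 hn)]
    with ν hν hlt l hl hmean
  by_contra! hle
  have hsum := ((summable_mean_terms μ l ν hμ.le hl.le hν).mul_left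
    ((n.factorial : ℝ) ^ ν / l ^ n)).sum_le_tsum (Finset.range (n + 1)) (fun y hy => by
      have hny : (n : ℝ) ≤ y := by
        have : n < y := by simpa using hy
        exact_mod_cast this.le
      have : 0 ≤ (y : ℝ) - μ := by linarith
      positivity)
  rw [tsum_mul_left, hmean, mul_zero, Finset.sum_range_succ] at hsum
  have hbound := Finset.sum_le_sum fun y hy =>
    mean_term_ge (l := l) hμ hε (Finset.mem_range.1 hy) (hlow y hy) hle
  rw [Finset.sum_neg_distrib] at hbound
  have htop : (n.factorial : ℝ) ^ ν / l ^ n * (((n : ℝ) - μ) * l ^ n / (n.factorial : ℝ) ^ ν) =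
      n - μ := by
    have : (0 : ℝ) < (n.factorial : ℝ) ^ ν := by positivity
    field_simp
  linarith

/-- Lemma 1: the solution `λ(ν)` of the mean constraint satisfies
`λ(ν)/μ^ν → ∞` and `λ(ν)/(μ+1)^ν → 0` as `ν → ∞`. -/
theorem stmt2 (μ : ℝ) (hμ : 0 < μ) (lam : ℝ → ℝ)
    (hlam : ∀ ν : ℝ, 0 < ν → 0 < lam ν ∧ meanConstraint μ (lam ν) ν) :
    Tendsto (fun ν : ℝ => lam ν / μ ^ ν) atTop atTop ∧
    Tendsto (fun ν : ℝ => lam ν / (μ + 1) ^ ν) atTop (𝓝 0) := by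
  constructor
  · refine tendsto_atTop.2 fun C => ?_
    filter_upwards [eventually_gt_atTop 0,
      eventually_lt_of_meanConstraint hμ (zero_lt_one.trans_le (le_max_right C 1))] with ν hν h
    have := h _ (hlam ν hν).1 (hlam ν hν).2
    exact (le_max_left C 1).trans ((le_div_iff₀ (by positivity)).2 this.le)
  · refine tendsto_order.2 ⟨fun a ha => ?_, fun ε hε => ?_⟩
    · filter_upwards [eventually_gt_atTop 0] with ν hν
      have := (hlam ν hν).1
      exact ha.trans (by positivity)
    · filter_upwards [eventually_gt_atTop 0, eventually_gt_of_meanConstraint hμ hε] with ν hν h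
      exact (div_lt_iff₀ (by positivity)).2 (h _ (hlam ν hν).1 (hlam ν hν).2)
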